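/- For every finite partially ordered set (X, <_P) whose comparability graph is a 3-regular planar bipartite graph, the order dimension of <_P is at most 7. -/

import Mathlib

/-- A simple graph is planar if it admits a planar drawing: an injective
placement of vertices in the plane together with, for each edge, a simple
continuous curve joining the images of its endpoints, such that curves
avoid vertex images in their interior and distinct edges have
internally-disjoint curves. -/
def IsPlanar {α : Type*} (G : SimpleGraph α) : Prop :=
  ∃ (pos : α → ℝ × ℝ) (γ : α → α → ℝ → ℝ × ℝ),
    Function.Injective pos ∧
    ∀ u v, G.Adj u v →
      ContinuousOn (γ u v) (Set.Icc 0 1) ∧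
      Set.InjOn (γ u v) (Set.Icc 0 1) ∧
      γ u v 0 = pos u ∧ γ u v 1 = pos v ∧
      (∀ t ∈ Set.Ioo (0 : ℝ) 1, ∀ w, γ u v t ≠ pos w) ∧
      (∀ u' v', G.Adj u' v' → ¬((u = u' ∧ v = v') ∨ (u = v' ∧ v = u')) →
        ∀ t ∈ Set.Ioo (0 : ℝ) 1, ∀ t' ∈ Set.Ioo (0 : ℝ) 1, γ u v t ≠ γ u' v' t')

open Finset in
/-- Greedy colouring with seven colours. -/
theorem greedy_seven {X : Type*} [Fintype X] (H : X → X → Prop)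
    (hs : ∀ x y, H x y → H y x)
    (F : X → Finset X) (hF : ∀ x y, H x y → y ∈ F x) (hF6 : ∀ x, #(F x) ≤ 6) :
    ∃ c : X → Fin 7, ∀ x y, x ≠ y → H x y → c x ≠ c y := by
  classical
  have key : ∀ s : Finset X, ∃ c : X → Fin 7, ∀ x ∈ s, ∀ y ∈ s, x ≠ y → H x y → c x ≠ c y := by
    intro s
    induction s using Finset.induction_on with
    | empty => exact ⟨fun _ => 0, by simp⟩
    | insert a s ha ih =>
      obtain ⟨c, hc⟩ := ih
      have h1 : ∃ k : Fin 7, k ∉ (F a).image c := by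
        by_contra! hcon
        have h2 : (univ : Finset (Fin 7)) ⊆ (F a).image c := fun k _ => hcon k
        have h3 := card_le_card h2
        have h4 : #((F a).image c) ≤ #(F a) := card_image_le
        have h5 := hF6 a
        simp at h3
        omega
      obtain ⟨k, hk⟩ := h1
      have hk' : ∀ y, H a y → c y ≠ k := by
        intro y hy he
        exact hk (mem_image.2 ⟨y, hF a y hy, he⟩)
      refine ⟨Function.update c a k, ?_⟩
      intro x hx y hy hxy hH
      rcases mem_insert.1 hx with rfl | hx'
      · rw [Function.update_self, Function.update_of_ne (Ne.symm hxy)]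
        exact (hk' y hH).symm
      · rcases mem_insert.1 hy with rfl | hy'
        · rw [Function.update_self, Function.update_of_ne hxy]
          exact hk' x (hs _ _ hH)
        · rw [Function.update_of_ne (by rintro rfl; exact ha hx'),
            Function.update_of_ne (by rintro rfl; exact ha hy')]
          exact hc x hx' y hy' hxy hH
  obtain ⟨c, hc⟩ := key univ
  exact ⟨c, fun x y => hc x (mem_univ _) y (mem_univ _)⟩

/-- Heights of the seven colour blocks in the seven cyclic block orders. -/
def blockHeight (m i : Fin 7) : ℕ := ![6, 5, 1, 4, 0, 2, 3] (i - m)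

theorem blockHeight_top : ∀ i k : Fin 7, k ≠ i → blockHeight i k < blockHeight i i := by
  decide

theorem blockHeight_second : ∀ i k l : Fin 7, k ≠ i → l ≠ i →
    ∃ m, m ≠ i ∧ blockHeight m k < blockHeight m i ∧ blockHeight m l < blockHeight m i := by
  decide

/-- If the comparability graph of a finite poset `(X, <)` is 3-regular,
planar and bipartite, then the order dimension of `<` is at most 7: there
are seven strict linear orders on `X` whose intersection is `<`. -/
theorem order_dimension_le_seven
    {X : Type*} [Fintype X] [PartialOrder X]
    (G : SimpleGraph X) (hG : ∀ x y : X, G.Adj x y ↔ (x < y ∨ y < x))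
    (hreg : ∀ x : X, Nat.card {y : X // G.Adj x y} = 3)
    (hbip : G.Colorable 2)
    (hplanar : IsPlanar G) :
    ∃ r : Fin 7 → X → X → Prop,
      (∀ i, IsStrictTotalOrder X (r i)) ∧
      ∀ x y : X, x < y ↔ ∀ i, r i x y := by
  classical
  have htri : ∀ x y z : X, x < y → y < z → False := by
    intro x y z hxy hyz
    obtain ⟨C⟩ := hbip
    have h1 := C.valid ((hG x y).2 (Or.inl hxy))
    have h2 := C.valid ((hG y z).2 (Or.inl hyz))
    have h3 := C.valid ((hG x z).2 (Or.inl (hxy.trans hyz)))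
    omega
  have hcard : ∀ x : X, (Finset.univ.filter (fun y => x < y ∨ y < x)).card = 3 := by
    intro x
    rw [← hreg x, Nat.card_eq_fintype_card, Fintype.card_subtype]
    congr 1
    ext y
    simp [hG]
  have hup : ∀ x : X, (Finset.univ.filter (fun y => x < y)).card ≤ 3 := by
    intro x
    rw [← hcard x]
    exact Finset.card_le_card (fun y => by simp; tauto)
  have hdn : ∀ x z : X, z < x → (Finset.univ.filter (fun y => y < x)).card = 3 := by
    intro x z hz
    rw [← hcard x]
    congr 1
    ext y
    simp only [Finset.mem_filter, Finset.mem_univ, true_and]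
    exact ⟨Or.inr, fun h => h.resolve_left (fun h => htri _ _ _ hz h)⟩
  -- the colouring
  obtain ⟨c, hc⟩ := greedy_seven (X := X) (fun x y => x ≠ y ∧ ∃ b, x < b ∧ y < b)
    (fun x y ⟨h, b, h1, h2⟩ => ⟨h.symm, b, h2, h1⟩)
    (fun x => (Finset.univ.filter (fun b => x < b)).biUnion
      (fun b => (Finset.univ.filter (fun y => y < b)).erase x))
    (by
      rintro x y ⟨h, b, h1, h2⟩
      simp only [Finset.mem_biUnion, Finset.mem_filter, Finset.mem_univ, true_and,
        Finset.mem_erase]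
      exact ⟨b, h1, h.symm, h2⟩)
    (by
      intro x
      refine (Finset.card_biUnion_le_card_mul _ _ 2 ?_).trans ?_
      · intro b hb
        have hb' : x < b := by simpa using hb
        rw [Finset.card_erase_of_mem (by simpa using hb'), hdn b x hb']
      · have := hup x
        omega)
  have hc' : ∀ x y b : X, x < b → y < b → x ≠ y → c x ≠ c y :=
    fun x y b h1 h2 h => hc x y h ⟨h, b, h1, h2⟩
  -- an injective numbering
  let e := Fintype.equivFin X
  let M := Fintype.card X
  let f : X → ℕ := fun x => (e x : ℕ)
  have hfM : ∀ x, f x < M := fun x => (e x).2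
  have hfinj : ∀ x y, f x = f y → x = y := fun x y h => e.injective (Fin.ext h)
  let K : Fin 7 → X → ℕ := fun m x =>
    blockHeight m (c x) * M + (if m = c x then f x else M - 1 - f x)
  have hK1 : ∀ m x y, blockHeight m (c x) < blockHeight m (c y) → K m x < K m y := by
    intro m x y h
    have h1 : (blockHeight m (c x) + 1) * M ≤ blockHeight m (c y) * M :=
      Nat.mul_le_mul_right M h
    have h2 := hfM x
    rw [Nat.add_mul, Nat.one_mul] at h1
    simp only [K]
    split_ifs <;> omega
  have hK2 : ∀ x y, c x = c y → f x < f y → K (c x) x < K (c x) y := by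
    intro x y h h1
    simp only [K, ← h, if_true]
    omega
  have hK3 : ∀ m x y, c x = c y → m ≠ c x → f x < f y → K m y < K m x := by
    intro m x y h hm h1
    simp only [K, ← h, if_neg hm]
    have := hfM y
    omega
  -- main reversal property
  have hrev : ∀ x b z : X, z < b → ¬ x < b → ∃ m, ∀ y, y < b → K m y < K m x := by
    intro x b z hzb hx
    by_cases h : ∃ a, a < b ∧ c a = c x
    · obtain ⟨a, hab, hac⟩ := h
      have hcol : ∀ y, y < b → y ≠ a → c y ≠ c x := by
        intro y hy hya
        rw [← hac]
        exact hc' y a b hy hab hya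
      have hne : f a ≠ f x := by
        intro h
        exact hx (hfinj _ _ h ▸ hab)
      rcases Nat.lt_or_gt_of_ne hne with hlt | hgt
      · refine ⟨c x, fun y hy => ?_⟩
        by_cases hya : y = a
        · subst hya
          rw [← hac]
          exact hK2 _ _ hac hlt
        · exact hK1 _ _ _ (blockHeight_top _ _ (hcol y hy hya))
      · have h3 := hdn b z hzb
        have h4 : ((Finset.univ.filter (fun y => y < b)).erase a).card = 2 := by
          rw [Finset.card_erase_of_mem (by simpa using hab), h3]
        obtain ⟨k, l, -, hkl⟩ := Finset.card_eq_two.1 h4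
        have hmem : ∀ y, (y ≠ a ∧ y < b) ↔ (y = k ∨ y = l) := by
          intro y
          have := congrArg (fun s => y ∈ s) hkl
          simpa using this
        have hk := (hmem k).2 (Or.inl rfl)
        have hl := (hmem l).2 (Or.inr rfl)
        obtain ⟨m, hm, hmk, hml⟩ := blockHeight_second (c x) (c k) (c l)
          (hcol k hk.2 hk.1) (hcol l hl.2 hl.1)
        refine ⟨m, fun y hy => ?_⟩
        by_cases hya : y = a
        · subst hya
          exact hK3 m x y hac.symm hm hgt
        · rcases (hmem y).1 ⟨hya, hy⟩ with rfl | rfl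
          · exact hK1 _ _ _ hmk
          · exact hK1 _ _ _ hml
    · push Not at h
      exact ⟨c x, fun y hy => hK1 _ _ _ (blockHeight_top _ _ (h y hy))⟩
  -- the orders
  let T : Fin 7 → X → ℕ := fun m x =>
    (Finset.univ.filter (fun y => y ≤ x ∧ IsMin y)).sup (K m)
  let lev : X → ℕ := fun x => if IsMin x then 0 else 1
  let g : Fin 7 → X → ℕ := fun m x => if m = 0 then f x else M - 1 - f x
  have hginj : ∀ m x y, g m x = g m y → x = y := by
    intro m x y h
    apply hfinj
    have h1 := hfM x
    have h2 := hfM y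
    simp only [g] at h
    split_ifs at h <;> omega
  have hTmin : ∀ m x, IsMin x → T m x = K m x := by
    intro m x hx
    have : (Finset.univ.filter (fun y => y ≤ x ∧ IsMin y)) = {x} := by
      ext y
      simp only [Finset.mem_filter, Finset.mem_univ, true_and, Finset.mem_singleton]
      exact ⟨fun h => hx.eq_of_le h.1, by rintro rfl; exact ⟨le_rfl, hx⟩⟩
    simp only [T, this, Finset.sup_singleton]
  have hmin : ∀ x y : X, x < y → IsMin x := by
    intro x y hxy z hz
    by_contra hn
    exact htri z x y (lt_of_le_not_ge hz hn) hxy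
  have hnmin : ∀ x y : X, x < y → ¬ IsMin y := fun x y h hy => hy.not_lt h
  have hex : ∀ x : X, ¬ IsMin x → ∃ z, z < x := fun x h => not_isMin_iff.1 h
  have hTle : ∀ m x y, x < y → K m x ≤ T m y := by
    intro m x y h
    exact Finset.le_sup (f := K m) (by simpa using ⟨h.le, hmin x y h⟩)
  have hTlt : ∀ m y n, ¬ IsMin y → (∀ z, z < y → K m z < n) → T m y < n := by
    intro m y n hy h
    obtain ⟨z, hz⟩ := hex y hy
    have h0 := h z hz
    refine (Finset.sup_lt_iff (by simp only [Nat.bot_eq_zero]; omega)).2 ?_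
    intro w hw
    simp only [Finset.mem_filter, Finset.mem_univ, true_and] at hw
    exact h w (lt_of_le_of_ne hw.1 (by rintro rfl; exact hy hw.2))
  refine ⟨fun m x y => T m x < T m y ∨ T m x = T m y ∧
    (lev x < lev y ∨ lev x = lev y ∧ g m x < g m y), ?_, ?_⟩
  · intro m
    refine { trichotomous := ?_, irrefl := ?_, trans := ?_ }
    · intro x y h1 h2
      apply hginj m
      omega
    · intro x h
      omega
    · intro x y z h1 h2
      omega
  · intro x y
    constructor
    · intro hxy m
      have h1 : T m x ≤ T m y := by
        rw [hTmin m x (hmin x y hxy)]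
        exact hTle m x y hxy
      have h2 : lev x = 0 := if_pos (hmin x y hxy)
      have h3 : lev y = 1 := if_neg (hnmin x y hxy)
      omega
    · intro h
      by_contra hxy
      have hT : ∀ m, T m x ≤ T m y := by
        intro m
        have := h m
        omega
      have hne : x ≠ y := by
        rintro rfl
        have := h 0
        omega
      by_cases hx : IsMin x
      · by_cases hy : IsMin y
        · have hT' : ∀ m, K m x ≤ K m y := by
            intro m
            rw [← hTmin m x hx, ← hTmin m y hy]
            exact hT m
          by_cases hcc : c x = c y
          · rcases Nat.lt_or_gt_of_ne (fun hh => hne (hfinj x y hh)) with hlt | hgt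
            · obtain ⟨m, hm⟩ := exists_ne (c x)
              exact absurd (hT' m) (not_le.2 (hK3 m x y hcc hm hlt))
            · exact absurd (hT' _) (not_le.2 (hK2 y x hcc.symm hgt))
          · exact absurd (hT' _) (not_le.2 (hK1 (c x) y x
              (blockHeight_top _ _ (fun hh => hcc hh.symm))))
        · obtain ⟨z, hz⟩ := hex y hy
          obtain ⟨m, hm⟩ := hrev x y z hz hxy
          have h1 := hTlt m y _ hy hm
          have h2 := hT m
          rw [hTmin m x hx] at h2
          omega
      · obtain ⟨z, hz⟩ := hex x hx
        by_cases hy : IsMin y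
        · have h3 := hdn x z hz
          have h4 : ∃ w, w < x ∧ c w ≠ c y := by
            by_contra! hcon
            obtain ⟨u, v, w, huv, -, -, hs⟩ := Finset.card_eq_three.1 h3
            have hu : u ∈ Finset.univ.filter (fun y => y < x) := by rw [hs]; simp
            have hv : v ∈ Finset.univ.filter (fun y => y < x) := by rw [hs]; simp
            simp only [Finset.mem_filter, Finset.mem_univ, true_and] at hu hv
            exact hc' u v x hu hv huv ((hcon u hu).trans (hcon v hv).symm)
          obtain ⟨w, hw, hwc⟩ := h4
          have h5 := hK1 (c w) y w (blockHeight_top _ _ (Ne.symm hwc))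
          have h6 := hTle (c w) w x hw
          have h7 := hT (c w)
          rw [hTmin _ y hy] at h7
          omega
        · by_cases hsub : ∀ w, w < x → w < y
          · obtain ⟨z', hz'⟩ := hex y hy
            have hs : Finset.univ.filter (fun w => w < x) = Finset.univ.filter (fun w => w < y) := by
              apply Finset.eq_of_subset_of_card_le
              · intro w
                simpa using hsub w
              · rw [hdn x z hz, hdn y z' hz']
            have hiff : ∀ w, w < x ↔ w < y := by
              intro w
              have := congrArg (fun s => w ∈ s) hs
              simpa using this
            have hTe : ∀ m, T m x = T m y := by
              intro m
              simp only [T]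
              congr 1
              ext w
              simp only [Finset.mem_filter, Finset.mem_univ, true_and]
              have h1 : ∀ v : X, ¬ IsMin v → (w ≤ v ∧ IsMin w ↔ w < v ∧ IsMin w) := by
                intro v hv
                refine and_congr_left (fun hw => ⟨fun hh => lt_of_le_of_ne hh ?_, le_of_lt⟩)
                rintro rfl
                exact hv hw
              rw [h1 x hx, h1 y hy, hiff]
            have hl : lev x = lev y := by simp only [lev, if_neg hx, if_neg hy]
            have g0 := h 0
            have g1 := h 1
            have e0 := hTe 0
            have e1 := hTe 1
            have g0' : g 0 x < g 0 y := by omega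
            have g1' : g 1 x < g 1 y := by omega
            simp only [g, if_true] at g0'
            rw [show g 1 x = M - 1 - f x from if_neg (by decide),
              show g 1 y = M - 1 - f y from if_neg (by decide)] at g1'
            omega
          · push Not at hsub
            obtain ⟨w, hw, hwy⟩ := hsub
            obtain ⟨z', hz'⟩ := hex y hy
            obtain ⟨m, hm⟩ := hrev w y z' hz' hwy
            have h1 := hTlt m y _ hy hm
            have h2 := hTle m w x hw
            have h3 := hT m
            omega
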